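/- Let r ≥ 2 and let G be an r-graph of order n. Then the function h_G(α) = λ^(α)(G)·n^{r/α} is nonincreasing on [1,∞): for all 1 ≤ α ≤ β, λ^(β)(G)·n^{r/β} ≤ λ^(α)(G)·n^{r/α}. Moreover, if G is not regular, then h_G is strictly decreasing: for all 1 ≤ α < β, λ^(β)(G)·n^{r/β} < λ^(α)(G)·n^{r/α}. -/

import Mathlib

/-!
Common definitions: `r`-uniform hypergraphs on vertex set `Fin n`, the polyform,
the parameter `λ^(α)`, degrees, properties of `r`-graphs, blow-ups, extremal
numbers and chromatic numbers.
-/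

open Finset

/-- An `r`-uniform hypergraph on the vertex set `Fin n`. -/
structure HGraph (r n : ℕ) where
  edges : Finset (Finset (Fin n))
  uniform : ∀ e ∈ edges, e.card = r

namespace HGraph

/-- The polyform `P_G(x) = r! ∑_{e ∈ E(G)} ∏_{i ∈ e} x_i`. -/
noncomputable def polyform {r n : ℕ} (G : HGraph r n) (x : Fin n → ℝ) : ℝ :=
  (r.factorial : ℝ) * ∑ e ∈ G.edges, ∏ i ∈ e, x i

/-- `λ^(α)(G)`: the maximum of the polyform over the unit sphere of `ℓ^α`. -/
noncomputable def lam {r n : ℕ} (α : ℝ) (G : HGraph r n) : ℝ :=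
  sSup {y : ℝ | ∃ x : Fin n → ℝ, (∑ i, |x i| ^ α) = 1 ∧ y = G.polyform x}

/-- The degree of a vertex: the number of edges containing it. -/
def degree {r n : ℕ} (G : HGraph r n) (v : Fin n) : ℕ :=
  (G.edges.filter (fun e => v ∈ e)).card

/-- Maximum degree `Δ(G)`. -/
def maxDeg {r n : ℕ} (G : HGraph r n) : ℕ :=
  Finset.univ.sup G.degree

/-- Minimum degree `δ(G)`. -/
noncomputable def minDeg {r n : ℕ} (G : HGraph r n) : ℕ :=
  sInf (Set.range G.degree)

/-- `G` is regular if all vertices have equal degrees. -/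
def Regular {r n : ℕ} (G : HGraph r n) : Prop :=
  ∀ u v : Fin n, G.degree u = G.degree v

/-- The induced subgraph of `G` along the embedding `f`. -/
def induce {r n m : ℕ} (G : HGraph r n) (f : Fin m ↪ Fin n) : HGraph r m where
  edges := Finset.univ.filter (fun e : Finset (Fin m) => e.map f ∈ G.edges)
  uniform := by
    intro e he
    rw [Finset.mem_filter] at he
    have h2 := G.uniform _ he.2
    rwa [Finset.card_map] at h2

/-- A property of `r`-graphs: a family closed under isomorphism (relabeling). -/
def IsProperty {r : ℕ} (P : ∀ n, Set (HGraph r n)) : Prop :=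
  ∀ n : ℕ, ∀ σ : Equiv.Perm (Fin n), ∀ G ∈ P n, G.induce σ.toEmbedding ∈ P n

/-- A hereditary property: closed under taking induced subgraphs. -/
def Hereditary {r : ℕ} (P : ∀ n, Set (HGraph r n)) : Prop :=
  ∀ n m : ℕ, ∀ f : Fin m ↪ Fin n, ∀ G ∈ P n, G.induce f ∈ P m

/-- A monotone property: closed under taking subgraphs. -/
def MonotoneProp {r : ℕ} (P : ∀ n, Set (HGraph r n)) : Prop :=
  ∀ n m : ℕ, ∀ f : Fin m ↪ Fin n, ∀ G ∈ P n, ∀ H : HGraph r m,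
    (∀ e ∈ H.edges, e.map f ∈ G.edges) → H ∈ P m

/-- `B`, together with the projection `φ : V(B) → V(G)`, is (a copy of) the blow-up
`G(k 1, …, k n)` of `G`: the fiber over a vertex `i` of `G` has `k i` vertices, and the
edges of `B` are exactly the transversals of the classes corresponding to edges of `G`. -/
def IsBlowup {r n N : ℕ} (G : HGraph r n) (k : Fin n → ℕ)
    (B : HGraph r N) (φ : Fin N → Fin n) : Prop :=
  (∀ i : Fin n, (Finset.univ.filter (fun v => φ v = i)).card = k i) ∧
  ∀ s : Finset (Fin N), s ∈ B.edges ↔ (Set.InjOn φ ↑s ∧ s.image φ ∈ G.edges)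

/-- A multiplicative property: contains all blow-ups of all of its members. -/
def MultiplicativeProp {r : ℕ} (P : ∀ n, Set (HGraph r n)) : Prop :=
  ∀ n : ℕ, ∀ G ∈ P n, ∀ k : Fin n → ℕ, (∀ i, 0 < k i) →
    ∀ N : ℕ, ∀ B : HGraph r N, ∀ φ : Fin N → Fin n, IsBlowup G k B φ → B ∈ P N

/-- The extremal number `ex(P, n)`: the maximum number of edges of a member of `P`
of order `n`. -/
noncomputable def exP {r : ℕ} (P : ∀ n, Set (HGraph r n)) (n : ℕ) : ℕ :=
  sSup {m : ℕ | ∃ G ∈ P n, G.edges.card = m}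

/-- `λ^(α)(P, n)`: the maximum of `λ^(α)(G)` over members `G` of `P` of order `n`. -/
noncomputable def lamP {r : ℕ} (α : ℝ) (P : ∀ n, Set (HGraph r n)) (n : ℕ) : ℝ :=
  sSup {y : ℝ | ∃ G ∈ P n, y = lam α G}

/-- The chromatic number: the least `k` such that the vertices can be `k`-colored
with no monochromatic edge (i.e. partitioned into `k` edgeless sets). -/
noncomputable def chrom {r n : ℕ} (G : HGraph r n) : ℕ :=
  sInf {k : ℕ | ∃ c : Fin n → Fin k, ∀ e ∈ G.edges, ¬ ∀ u ∈ e, ∀ w ∈ e, c u = c w}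

/-- The weak chromatic number: the least `k` such that the vertices can be `k`-colored
with every edge getting `r` distinct colors (every class meets every edge in ≤ 1 vertex). -/
noncomputable def wchrom {r n : ℕ} (G : HGraph r n) : ℕ :=
  sInf {k : ℕ | ∃ c : Fin n → Fin k, ∀ e ∈ G.edges, Set.InjOn c ↑e}

/-- `Mon(H)`: the (monotone, hereditary) property of all `r`-graphs containing no
subgraph isomorphic to `H`. -/
def MonP {r h : ℕ} (H : HGraph r h) : ∀ n, Set (HGraph r n) :=
  fun n => {G | ¬ ∃ f : Fin h ↪ Fin n, ∀ e ∈ H.edges, e.map f ∈ G.edges}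

end HGraph

open HGraph

namespace HGraph

lemma polyform_smul {r n : ℕ} (G : HGraph r n) (c : ℝ) (x : Fin n → ℝ) :
    G.polyform (fun i => c * x i) = c ^ r * G.polyform x := by
  unfold polyform
  rw [mul_left_comm]
  congr 1
  rw [Finset.mul_sum]
  refine Finset.sum_congr rfl fun e he => ?_
  rw [Finset.prod_mul_distrib, Finset.prod_const, G.uniform e he]

lemma polyform_le_abs {r n : ℕ} (G : HGraph r n) (x : Fin n → ℝ) :
    G.polyform x ≤ G.polyform fun i => |x i| := by
  unfold polyform
  refine mul_le_mul_of_nonneg_left (Finset.sum_le_sum fun e _ => ?_) (by positivity)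
  rw [← Finset.abs_prod]
  exact le_abs_self _

lemma continuous_polyform {r n : ℕ} (G : HGraph r n) : Continuous G.polyform := by
  unfold polyform
  fun_prop

lemma polyform_zero {r n : ℕ} (hr : r ≠ 0) (G : HGraph r n) :
    G.polyform (fun _ => 0) = 0 := by
  simpa [hr] using G.polyform_smul 0 (fun _ => 0)

lemma isCompact_rpow_sphere {n : ℕ} {α : ℝ} (hα : 0 < α) :
    IsCompact {x : Fin n → ℝ | ∑ i, |x i| ^ α = 1} := by
  refine (isCompact_univ_pi fun _ : Fin n => isCompact_Icc (a := (-1 : ℝ)) (b := 1)).of_isClosed_subset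
    (isClosed_eq (continuous_finsetSum _ fun i _ =>
      (continuous_apply i).abs.rpow_const fun _ => Or.inr hα.le) continuous_const) ?_
  intro x hx i _
  have hx : ∑ i, |x i| ^ α = 1 := hx
  have h : |x i| ^ α ≤ 1 := hx ▸ Finset.single_le_sum (f := fun i => |x i| ^ α)
    (fun _ _ => by positivity) (Finset.mem_univ i)
  exact abs_le.mp (le_of_not_gt fun h1 => (Real.one_lt_rpow h1 hα).not_ge h)

lemma bddAbove_polyform {r n : ℕ} (G : HGraph r n) {α : ℝ} (hα : 0 < α) :
    BddAbove {y : ℝ | ∃ x : Fin n → ℝ, (∑ i, |x i| ^ α) = 1 ∧ y = G.polyform x} := by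
  refine ((isCompact_rpow_sphere hα).bddAbove_image G.continuous_polyform.continuousOn).mono ?_
  rintro y ⟨x, hx, rfl⟩
  exact ⟨x, hx, rfl⟩

lemma sum_const_rpow {n : ℕ} (hn : n ≠ 0) {α : ℝ} (hα : 0 < α) :
    ∑ _i : Fin n, |((n : ℝ) ^ (-(1 / α)))| ^ α = 1 := by
  have hn' : (0 : ℝ) < n := by positivity
  rw [Finset.sum_const, abs_of_pos (by positivity), ← Real.rpow_mul hn'.le]
  simp [hα.ne', Real.rpow_neg_one, hn]

lemma exists_polyform_eq_lam {r n : ℕ} (hn : n ≠ 0) (G : HGraph r n) {α : ℝ} (hα : 0 < α) :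
    ∃ x : Fin n → ℝ, ∑ i, |x i| ^ α = 1 ∧ G.polyform x = lam α G := by
  obtain ⟨x, hx, hmax⟩ := (isCompact_rpow_sphere (n := n) hα).exists_isMaxOn
    ⟨_, sum_const_rpow hn hα⟩ G.continuous_polyform.continuousOn
  refine ⟨x, hx, le_antisymm (le_csSup (G.bddAbove_polyform hα) ⟨x, hx, rfl⟩)
    (csSup_le ⟨_, x, hx, rfl⟩ ?_)⟩
  rintro y ⟨z, hz, rfl⟩
  exact hmax hz

/-- The homogeneous form of the inequality defining `lam`. -/
lemma polyform_le_lam_mul {r n : ℕ} (hr : r ≠ 0) (G : HGraph r n) {α : ℝ} (hα : 0 < α)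
    (x : Fin n → ℝ) :
    G.polyform x ≤ lam α G * (∑ i, |x i| ^ α) ^ ((r : ℝ) / α) := by
  set S := ∑ i, |x i| ^ α with hS
  have hS0 : 0 ≤ S := Finset.sum_nonneg fun _ _ => by positivity
  rcases hS0.eq_or_lt with h | h
  · have hx : x = fun _ => 0 := by
      funext i
      have := (Finset.sum_eq_zero_iff_of_nonneg (fun i _ => by positivity)).mp
        (hS.symm.trans h.symm) i (Finset.mem_univ i)
      simpa using ((Real.rpow_eq_zero (abs_nonneg _) hα.ne').mp this)
    rw [← h, Real.zero_rpow (by positivity), mul_zero, hx, polyform_zero hr]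
  · set c := S ^ (-(1 / α))
    have hc : 0 < c := by positivity
    have hcα : c ^ α = S⁻¹ := by
      rw [← Real.rpow_mul hS0, ← Real.rpow_neg_one]
      congr 1
      field_simp
    have hcr : c ^ r * S ^ ((r : ℝ) / α) = 1 := by
      rw [← Real.rpow_natCast, ← Real.rpow_mul hS0, ← Real.rpow_add h]
      convert Real.rpow_zero S using 2
      field_simp
      ring
    have hle : c ^ r * G.polyform x ≤ lam α G := by
      rw [← polyform_smul]
      refine le_csSup (G.bddAbove_polyform hα) ⟨_, ?_, rfl⟩
      simp_rw [abs_mul, abs_of_pos hc, Real.mul_rpow hc.le (abs_nonneg _), ← Finset.mul_sum]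
      rw [hcα, ← hS, inv_mul_cancel₀ h.ne']
    calc G.polyform x = (c ^ r * G.polyform x) * S ^ ((r : ℝ) / α) := by
          rw [mul_right_comm, hcr, one_mul]
      _ ≤ _ := by gcongr

lemma polyform_one {r n : ℕ} (G : HGraph r n) :
    G.polyform (fun _ => 1) = r.factorial * G.edges.card := by
  simp [polyform]

lemma le_lam_mul_rpow {r n : ℕ} (hr : r ≠ 0) (G : HGraph r n) {α : ℝ} (hα : 0 < α) :
    (r.factorial * G.edges.card : ℝ) ≤ lam α G * (n : ℝ) ^ ((r : ℝ) / α) := by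
  rw [← polyform_one]
  simpa using G.polyform_le_lam_mul hr hα fun _ => 1

lemma lam_nonneg {r n : ℕ} (hr : r ≠ 0) (hn : n ≠ 0) (G : HGraph r n) {α : ℝ} (hα : 0 < α) :
    0 ≤ lam α G :=
  nonneg_of_mul_nonneg_left ((by positivity : (0 : ℝ) ≤ r.factorial * G.edges.card).trans
    (G.le_lam_mul_rpow hr hα)) (by positivity)

lemma lam_pos {r n : ℕ} (hr : r ≠ 0) (hn : n ≠ 0) (G : HGraph r n) (hG : G.edges.Nonempty)
    {α : ℝ} (hα : 0 < α) : 0 < lam α G := by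
  have := hG.card_pos
  exact pos_of_mul_pos_left ((by positivity : (0 : ℝ) < r.factorial * G.edges.card).trans_le
    (G.le_lam_mul_rpow hr hα)) (by positivity)

lemma sum_sum_ite_eq_degree {r n : ℕ} (G : HGraph r n) (v : Fin n) :
    ∑ e ∈ G.edges, ∑ i ∈ e, (if i = v then (1 : ℝ) else 0) = G.degree v := by
  simp [degree]

lemma hasDerivAt_polyform_one_add {r n : ℕ} (G : HGraph r n) (s : Fin n → ℝ) :
    HasDerivAt (fun t : ℝ => G.polyform fun i => 1 + t * s i)
      (r.factorial * ∑ e ∈ G.edges, ∑ i ∈ e, s i) 0 := by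
  unfold polyform
  refine (HasDerivAt.fun_sum fun e _ => ?_).const_mul _
  have h := HasDerivAt.fun_finsetProd (u := e) (f := fun i (t : ℝ) => 1 + t * s i) (f' := s)
    (x := (0 : ℝ)) fun i _ => by
      simpa using ((hasDerivAt_id (0 : ℝ)).mul_const (s i)).const_add 1
  simpa using h

lemma hasDerivAt_sum_one_add_rpow {n : ℕ} (β : ℝ) (s : Fin n → ℝ) :
    HasDerivAt (fun t : ℝ => ∑ i, |1 + t * s i| ^ β) (∑ i, s i * β) 0 := by
  refine HasDerivAt.fun_sum (u := Finset.univ)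
    (A := fun i (t : ℝ) => |1 + t * s i| ^ β) fun i _ => ?_
  have h : HasDerivAt (fun t : ℝ => 1 + t * s i) (s i) 0 := by
    simpa using ((hasDerivAt_id (0 : ℝ)).mul_const (s i)).const_add 1
  have h1 : HasDerivAt (fun t : ℝ => (1 + t * s i) ^ β) (s i * β) 0 := by
    simpa using h.rpow_const (p := β) (Or.inl (by simp))
  refine h1.congr_of_eventuallyEq ?_
  have : ∀ᶠ t : ℝ in nhds 0, 0 < 1 + t * s i :=
    h.continuousAt.eventually_const_lt (by simp)
  filter_upwards [this] with t ht
  rw [abs_of_pos ht]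

/-- If a constant vector attains `lam β G`, then the graph is regular. -/
lemma regular_of_lam_mul_rpow_le {r n : ℕ} (hr : r ≠ 0) (G : HGraph r n) {β : ℝ}
    (hβ : 0 < β) (h : lam β G * (n : ℝ) ^ ((r : ℝ) / β) ≤ r.factorial * G.edges.card) :
    Regular G := by
  intro u v
  have hn : (n : ℝ) ≠ 0 := by
    have := u.pos
    positivity
  set s : Fin n → ℝ := fun i => (if i = u then (1 : ℝ) else 0) - if i = v then 1 else 0 with hs
  have hs0 : ∑ i, s i = 0 := by simp [hs]
  have hP := G.hasDerivAt_polyform_one_add s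
  have hN := hasDerivAt_sum_one_add_rpow β s
  rw [← Finset.sum_mul, hs0, zero_mul] at hN
  have hN' := ((hN.rpow_const (p := (r : ℝ) / β) (Or.inl (by simpa using hn))).const_mul
    (lam β G)).sub hP
  have hmin : IsLocalMin (fun t : ℝ => lam β G * (∑ i, |1 + t * s i| ^ β) ^ ((r : ℝ) / β) -
      G.polyform fun i => 1 + t * s i) 0 := by
    refine Filter.Eventually.of_forall fun t => ?_
    have h0 := G.polyform_le_lam_mul hr hβ fun i => 1 + t * s i
    have h1 := G.polyform_one
    simp only [zero_mul, add_zero, abs_one, Real.one_rpow, Finset.sum_const, Finset.card_univ,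
      Fintype.card_fin, nsmul_eq_mul, mul_one]
    linarith
  have hz := hmin.hasDerivAt_eq_zero hN'
  simp only [zero_mul, mul_zero, zero_sub, neg_eq_zero, mul_eq_zero, Nat.cast_eq_zero,
    Nat.factorial_ne_zero, false_or] at hz
  simp only [hs, Finset.sum_sub_distrib, sum_sum_ite_eq_degree] at hz
  exact_mod_cast sub_eq_zero.mp hz

lemma nonempty_edges_of_not_regular {r n : ℕ} (G : HGraph r n) (h : ¬ Regular G) :
    G.edges.Nonempty := by
  rw [Finset.nonempty_iff_ne_empty]
  intro h0
  exact h fun u v => by simp [degree, h0]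

end HGraph

lemma Real.inv_mul_rpow_one_sub_rpow {c α β : ℝ} (hc : 0 < c) (hα : α ≠ 0) (hβ : β ≠ 0) :
    (c⁻¹ * c ^ (1 - α / β)) ^ (β / α) = c⁻¹ := by
  rw [← Real.rpow_neg_one, ← Real.rpow_add hc, ← Real.rpow_mul hc.le]
  congr 1
  field_simp
  ring

lemma Real.sum_inv_card_mul_rpow {n : ℕ} {α β : ℝ} (hα : α ≠ 0) {x : Fin n → ℝ}
    (hx : ∑ i, |x i| ^ β = 1) :
    ∑ i, (n : ℝ)⁻¹ * (|x i| ^ α) ^ (β / α) = (n : ℝ)⁻¹ := by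
  simp_rw [← Real.rpow_mul (abs_nonneg _), mul_div_cancel₀ _ hα, ← Finset.mul_sum, hx, mul_one]

/-- The power mean inequality, for vectors on the unit sphere of `ℓ^β`. -/
lemma Real.sum_rpow_le_card_rpow {n : ℕ} (hn : n ≠ 0) {α β : ℝ} (hα : 0 < α) (hαβ : α ≤ β)
    {x : Fin n → ℝ} (hx : ∑ i, |x i| ^ β = 1) :
    ∑ i, |x i| ^ α ≤ (n : ℝ) ^ (1 - α / β) := by
  have hβ : 0 < β := hα.trans_le hαβ
  have hn' : (0 : ℝ) < n := by positivity
  have h := (convexOn_rpow ((one_le_div hα).mpr hαβ)).map_sum_le (t := Finset.univ)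
    (w := fun _ : Fin n => (n : ℝ)⁻¹) (p := fun i => |x i| ^ α) (fun _ _ => by positivity)
    (by simp [hn]) (fun _ _ => Set.mem_Ici.mpr (by positivity))
  simp only [smul_eq_mul] at h
  rw [Real.sum_inv_card_mul_rpow hα.ne' hx, ← Finset.mul_sum] at h
  replace h := h.trans_eq (Real.inv_mul_rpow_one_sub_rpow hn' hα.ne' hβ.ne').symm
  rw [Real.rpow_le_rpow_iff (by positivity) (by positivity) (by positivity)] at h
  exact le_of_mul_le_mul_left h (by positivity)

lemma Real.sum_rpow_lt_card_rpow {n : ℕ} (hn : n ≠ 0) {α β : ℝ} (hα : 0 < α) (hαβ : α < β)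
    {x : Fin n → ℝ} (hx : ∑ i, |x i| ^ β = 1) {j k : Fin n} (hjk : |x j| ≠ |x k|) :
    ∑ i, |x i| ^ α < (n : ℝ) ^ (1 - α / β) := by
  have hβ : 0 < β := hα.trans hαβ
  have hn' : (0 : ℝ) < n := by positivity
  have hne : |x j| ^ α ≠ |x k| ^ α := fun h =>
    hjk ((Real.rpow_left_inj (abs_nonneg _) (abs_nonneg _) hα.ne').mp h)
  have h := (strictConvexOn_rpow ((one_lt_div hα).mpr hαβ)).map_sum_lt (t := Finset.univ)
    (w := fun _ : Fin n => (n : ℝ)⁻¹) (p := fun i => |x i| ^ α) (fun _ _ => by positivity)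
    (by simp [hn]) (fun _ _ => Set.mem_Ici.mpr (by positivity))
    ⟨j, Finset.mem_univ j, k, Finset.mem_univ k, hne⟩
  simp only [smul_eq_mul] at h
  rw [Real.sum_inv_card_mul_rpow hα.ne' hx, ← Finset.mul_sum] at h
  replace h := h.trans_eq (Real.inv_mul_rpow_one_sub_rpow hn' hα.ne' hβ.ne').symm
  rw [Real.rpow_lt_rpow_iff (by positivity) (by positivity) (by positivity)] at h
  exact lt_of_mul_lt_mul_left h (by positivity)

lemma Real.card_rpow_rpow_mul {n : ℕ} (hn : n ≠ 0) {α β : ℝ} (hα : α ≠ 0) (hβ : β ≠ 0) (r : ℝ) :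
    ((n : ℝ) ^ (1 - α / β)) ^ (r / α) * (n : ℝ) ^ (r / β) = (n : ℝ) ^ (r / α) := by
  have hn' : (0 : ℝ) < n := by positivity
  rw [← Real.rpow_mul hn'.le, ← Real.rpow_add hn']
  congr 1
  field_simp
  ring

/-- Proposition 5: `h_G(α) = λ^(α)(G)·n^{r/α}` is nonincreasing in
`α` on `[1, ∞)`, and strictly decreasing if `G` is not regular. -/
theorem stmt4 {r n : ℕ} (hr : 2 ≤ r) (G : HGraph r n) :
    (∀ α β : ℝ, 1 ≤ α → α ≤ β →
      lam β G * (n : ℝ) ^ ((r : ℝ) / β) ≤ lam α G * (n : ℝ) ^ ((r : ℝ) / α)) ∧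
    (¬ Regular G → ∀ α β : ℝ, 1 ≤ α → α < β →
      lam β G * (n : ℝ) ^ ((r : ℝ) / β) < lam α G * (n : ℝ) ^ ((r : ℝ) / α)) := by
  have hr0 : r ≠ 0 := by omega
  refine ⟨fun α β hα1 hαβ => ?_, fun hG α β hα1 hαβ => ?_⟩
  · have hα : 0 < α := by linarith
    have hβ : 0 < β := by linarith
    rcases eq_or_ne n 0 with rfl | hn
    · rw [Nat.cast_zero, Real.zero_rpow (by positivity), Real.zero_rpow (by positivity)]
      simp
    obtain ⟨x, hx, hxl⟩ := G.exists_polyform_eq_lam hn hβ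
    have hlam := G.lam_nonneg hr0 hn hα
    have hsum := Real.sum_rpow_le_card_rpow hn hα hαβ hx
    rw [← Real.card_rpow_rpow_mul hn hα.ne' hβ.ne', ← mul_assoc, ← hxl]
    refine mul_le_mul_of_nonneg_right ((G.polyform_le_lam_mul hr0 hα x).trans ?_) (by positivity)
    gcongr
  · have hα : 0 < α := by linarith
    have hβ : 0 < β := by linarith
    have hn : n ≠ 0 := by
      rintro rfl
      exact hG fun u => u.elim0
    obtain ⟨x, hx, hxl⟩ := G.exists_polyform_eq_lam hn hβ
    have hlam := G.lam_pos hr0 hn (G.nonempty_edges_of_not_regular hG) hα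
    by_cases hc : ∀ j k, |x j| = |x k|
    · refine absurd (G.regular_of_lam_mul_rpow_le hr0 hβ ?_) hG
      set c := |x ⟨0, Nat.pos_of_ne_zero hn⟩| with hcdef
      have hc0 : 0 ≤ c := abs_nonneg _
      have hxc : ∀ i, |x i| = c := fun i => hc i _
      have hnc : (n : ℝ) * c ^ β = 1 := by simpa [hxc] using hx
      have hcr : c ^ r * (n : ℝ) ^ ((r : ℝ) / β) = 1 := by
        have h : c ^ r = (c ^ β) ^ ((r : ℝ) / β) := by
          rw [← Real.rpow_mul hc0, mul_div_cancel₀ _ hβ.ne', Real.rpow_natCast]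
        rw [h, ← Real.mul_rpow (by positivity) (by positivity), mul_comm, hnc, Real.one_rpow]
      have hle : lam β G ≤ c ^ r * (r.factorial * G.edges.card) := by
        rw [← hxl, ← G.polyform_one, ← G.polyform_smul]
        simpa [hxc] using G.polyform_le_abs x
      calc _ ≤ c ^ r * (r.factorial * G.edges.card) * (n : ℝ) ^ ((r : ℝ) / β) := by gcongr
        _ = _ := by rw [mul_right_comm, hcr, one_mul]
    · push Not at hc
      obtain ⟨j, k, hjk⟩ := hc
      have hsum := Real.sum_rpow_lt_card_rpow hn hα hαβ hx hjk
      have hS : 0 ≤ ∑ i, |x i| ^ α := Finset.sum_nonneg fun _ _ => by positivity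
      have hrα : 0 < (r : ℝ) / α := by positivity
      rw [← Real.card_rpow_rpow_mul hn hα.ne' hβ.ne', ← mul_assoc, ← hxl]
      refine mul_lt_mul_of_pos_right ((G.polyform_le_lam_mul hr0 hα x).trans_lt ?_) (by positivity)
      gcongr
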